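/- If the center is not helpless and there exists some protocol in which the truthful profile (s^t,…,s^t) is an equilibrium (not necessarily unique), then (s^t,…,s^t) is the unique equilibrium of the competitive protocol F^c. -/

import Mathlib

open scoped Classical
noncomputable section

/-- A strategy of an agent: `(p, q)` with `p = P(mᵢ = 0 ∣ bᵢ = 0)`, `q = P(mᵢ = 0 ∣ bᵢ = 1)`. -/
abbrev Strategy : Type := (Set.Icc (0:ℝ) 1) × (Set.Icc (0:ℝ) 1)

/-- The truthful strategy `sᵗ = (1,0)`. -/
def sT : Strategy := (⟨1, by norm_num⟩, ⟨0, by norm_num⟩)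

/-- A zero-information strategy: `p = q`. -/
def ZeroInfo (s : Strategy) : Prop := (s.1 : ℝ) = (s.2 : ℝ)

/-- Vectors of `N+1` bits (bits of the center and the `N` agents; also used for
message vectors and for the center's replies).  Coordinate `0` is the center. -/
abbrev Bits (N : ℕ) : Type := Fin (N+1) → Bool

/-- A strategy profile of the `N` agents. -/
abbrev Profile (N : ℕ) : Type := Fin N → Strategy

/-- A protocol for a single agent: a map from strategy profiles and message vectors to
distributions over replies `f ∈ {0,1}^{N+1}`. -/
abbrev Protocol (N : ℕ) : Type := Profile N → Bits N → PMF (Bits N)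

/-- `P(message = msg ∣ bit = bit)` under strategy `s` (where `false` plays the role of `0`). -/
def strandP (s : Strategy) (bit msg : Bool) : ℝ :=
  if msg then 1 - (if bit then (s.2 : ℝ) else (s.1 : ℝ))
  else (if bit then (s.2 : ℝ) else (s.1 : ℝ))

/-- `P(messages = m ∣ bits = b)` under profile `s`; the center's message is her own bit. -/
def msgP {N : ℕ} (s : Profile N) (b m : Bits N) : ℝ :=
  (if m 0 = b 0 then (1:ℝ) else 0) * ∏ i : Fin N, strandP (s i) (b i.succ) (m i.succ)

/-- Joint probability of bits `b`, messages `m` and reply `f` (to the relevant agent),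
under profile `s` and protocol `F`; bits are i.i.d. uniform. -/
def jointP {N : ℕ} (s : Profile N) (F : Protocol N) (b m f : Bits N) : ℝ :=
  ((1:ℝ)/2)^(N+1) * msgP s b m * ((F s m) f).toReal

/-- `P(bᵢ = bi, mᵢ = mi, fᵢ = f, g(b) = val)` for agent `i` (coordinate `i.succ`). -/
def pObs {N : ℕ} (g : Bits N → Bool) (s : Profile N) (F : Protocol N) (i : Fin N)
    (bi mi : Bool) (f : Bits N) (val : Bool) : ℝ :=
  ∑ b : Bits N, ∑ m : Bits N,
    if b i.succ = bi ∧ m i.succ = mi ∧ g b = val then jointP s F b m f else 0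

/-- `P(bᵢ = bi, mᵢ = mi, fᵢ = f)` for agent `i`. -/
def pObsAll {N : ℕ} (s : Profile N) (F : Protocol N) (i : Fin N)
    (bi mi : Bool) (f : Bits N) : ℝ :=
  ∑ b : Bits N, ∑ m : Bits N,
    if b i.succ = bi ∧ m i.succ = mi then jointP s F b m f else 0

/-- `P(b_k = 1, bᵢ = bi, mᵢ = mi, fᵢ = f)` for agent `i`. -/
def pBit {N : ℕ} (s : Profile N) (F : Protocol N) (i : Fin N)
    (bi mi : Bool) (f : Bits N) (k : Fin (N+1)) : ℝ :=
  ∑ b : Bits N, ∑ m : Bits N,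
    if b i.succ = bi ∧ m i.succ = mi ∧ b k = true then jointP s F b m f else 0

/-- The posterior `v_k = P(b_k = 1 ∣ fᵢ, mᵢ, bᵢ)` of agent `i` at the realization
`(bi, mi, f)`. -/
def post {N : ℕ} (s : Profile N) (F : Protocol N) (i : Fin N)
    (bi mi : Bool) (f : Bits N) (k : Fin (N+1)) : ℝ :=
  pBit s F i bi mi f k / pObsAll s F i bi mi f

/-- Expected profit `V_i(s⃗; F_i)`: after observing `(bᵢ, mᵢ, fᵢ)` the agent guesses the
more likely value of `g(b)` (uniformly at random in case of a tie) and earns `c i` iff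
the guess is correct. -/
def V {N : ℕ} (g : Bits N → Bool) (c : Fin N → ℝ) (s : Profile N) (F : Protocol N)
    (i : Fin N) : ℝ :=
  c i * ∑ bi : Bool, ∑ mi : Bool, ∑ f : Bits N,
    (if pObs g s F i bi mi f true > pObs g s F i bi mi f false then pObs g s F i bi mi f true
     else if pObs g s F i bi mi f false > pObs g s F i bi mi f true then
       pObs g s F i bi mi f false
     else (pObs g s F i bi mi f false + pObs g s F i bi mi f true) / 2)

/-- Utility `U_i(s⃗; F_i) = V_i(s⃗; F_i) − priceᵢ(sᵢ)`. -/
def U {N : ℕ} (g : Bits N → Bool) (c : Fin N → ℝ) (price : Fin N → Strategy → ℝ)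
    (s : Profile N) (F : Protocol N) (i : Fin N) : ℝ :=
  V g c s F i - price i (s i)

/-- The all-truthful profile `(sᵗ, …, sᵗ)`. -/
def truthProfile (N : ℕ) : Profile N := fun _ => sT

/-- `s⃗` is an equilibrium of the protocol `F = (F_1,…,F_N)`. -/
def Equilibrium {N : ℕ} (g : Bits N → Bool) (c : Fin N → ℝ) (price : Fin N → Strategy → ℝ)
    (s : Profile N) (FF : Fin N → Protocol N) : Prop :=
  ∀ i : Fin N, ∀ s' : Strategy,
    U g c price s (FF i) i ≥ U g c price (Function.update s i s') (FF i) i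

/-- The improvement `F_i⁺` of a protocol `F_i`: it agrees with `F_i` when `s_i` is a
zero-information strategy, and otherwise returns the reply whose first coordinate is
`m₀ = b₀` and whose remaining coordinates are those of `F_i`'s reply. -/
def improve {N : ℕ} (i : Fin N) (F : Protocol N) : Protocol N := fun s m =>
  if ZeroInfo (s i) then F s m
  else PMF.map (fun f => Function.update f 0 (m 0)) (F s m)

/-- The center is helpless. -/
def Helpless (N : ℕ) (g : Bits N → Bool) (c : Fin N → ℝ)
    (price : Fin N → Strategy → ℝ) : Prop :=
  ∀ i : Fin N, ∀ F : Protocol N, ∀ si : Strategy, ¬ ZeroInfo si →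
    ∀ sr : Profile N, (∀ j, ZeroInfo (sr j)) →
      U g c price sr F i ≥ U g c price (Function.update sr i si) (improve i F) i

/-- Relative price `price_i^r(s_i) = price_i(s_i) / price_i(sᵗ)`. -/
def priceR {N : ℕ} (price : Fin N → Strategy → ℝ) (i : Fin N) (s : Strategy) : ℝ :=
  price i s / price i sT

/-- The competitive protocol (the component `F_i^c` for agent `i`). -/
def Fc {N : ℕ} (price : Fin N → Strategy → ℝ) (i : Fin N) : Protocol N := fun s m =>
  if ∀ j, s j = sT then PMF.pure m
  else if ∀ j, j ≠ i → priceR price j (s j) < priceR price i (s i) then PMF.pure m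
  else PMF.uniformOfFintype (Bits N)

/-- The protocol that always replies the full message vector `m = (b₀, m₁, …, m_N)`. -/
def Fmax (N : ℕ) : Protocol N := fun _ m => PMF.pure m

/-- The protocol that always replies `N+1` independent uniform random bits. -/
def Fmin (N : ℕ) : Protocol N := fun _ _ => PMF.uniformOfFintype (Bits N)

/-- Agent `i` is fanatic. -/
def Fanatic {N : ℕ} (g : Bits N → Bool) (c : Fin N → ℝ) (price : Fin N → Strategy → ℝ)
    (i : Fin N) : Prop :=
  ∀ s : Profile N,
    price i sT > V g c (truthProfile N) (Fmax N) i - V g c s (Fmin N) i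

/-- The fair competitive protocol (the component `F_i^{fc}` for agent `i`). -/
def Ffc {N : ℕ} (price : Fin N → Strategy → ℝ) (i : Fin N) : Protocol N := fun s m =>
  if s i = sT then PMF.pure m
  else if (∃ j, j ≠ i ∧ s j ≠ sT) ∧
      (∀ j, j ≠ i → s j ≠ sT → priceR price j (s j) < priceR price i (s i)) then PMF.pure m
  else PMF.uniformOfFintype (Bits N)

/-- `P(bᵢ = bi, g(b) = val)`. -/
def pOwn {N : ℕ} (g : Bits N → Bool) (i : Fin N) (bi val : Bool) : ℝ :=
  ∑ b : Bits N, if b i.succ = bi ∧ g b = val then ((1:ℝ)/2)^(N+1) else 0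

/-- `P(bᵢ = bi, b₀ = b0, g(b) = val)`. -/
def pPair {N : ℕ} (g : Bits N → Bool) (i : Fin N) (bi b0 val : Bool) : ℝ :=
  ∑ b : Bits N, if b i.succ = bi ∧ b 0 = b0 ∧ g b = val then ((1:ℝ)/2)^(N+1) else 0

/-- `P(bᵢ = bi, messages = m, g(b) = val)` under profile `s`. -/
def pMsg {N : ℕ} (g : Bits N → Bool) (s : Profile N) (i : Fin N) (bi : Bool) (m : Bits N)
    (val : Bool) : ℝ :=
  ∑ b : Bits N, if b i.succ = bi ∧ g b = val then ((1:ℝ)/2)^(N+1) * msgP s b m else 0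

/-- Expected profit of agent `i` when she only knows `bᵢ`. -/
def ownProfit {N : ℕ} (g : Bits N → Bool) (c : Fin N → ℝ) (i : Fin N) : ℝ :=
  c i * ∑ bi : Bool, max (pOwn g i bi true) (pOwn g i bi false)

/-- Expected profit of agent `i` when she only knows `b₀` and `bᵢ`. -/
def pairProfit {N : ℕ} (g : Bits N → Bool) (c : Fin N → ℝ) (i : Fin N) : ℝ :=
  c i * ∑ bi : Bool, ∑ b0 : Bool, max (pPair g i bi b0 true) (pPair g i bi b0 false)

/-- Expected profit of agent `i` when she knows `bᵢ` and all the messages. -/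
def fullProfit {N : ℕ} (g : Bits N → Bool) (c : Fin N → ℝ) (s : Profile N) (i : Fin N) : ℝ :=
  c i * ∑ bi : Bool, ∑ m : Bits N, max (pMsg g s i bi m true) (pMsg g s i bi m false)

lemma strandP_nonneg (s : Strategy) (a b : Bool) : 0 ≤ strandP s a b := by
  have h1 := s.1.2
  have h2 := s.2.2
  simp only [Set.mem_Icc] at h1 h2
  unfold strandP
  cases a <;> cases b <;> simp <;> linarith

lemma sum_strandP (s : Strategy) (a : Bool) : ∑ b, strandP s a b = 1 := by
  simp [strandP]

lemma strandP_of_zeroInfo {s : Strategy} (h : ZeroInfo s) (a a' b : Bool) :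
    strandP s a b = strandP s a' b := by
  unfold ZeroInfo at h
  cases a <;> cases a' <;> simp [strandP, h]

lemma msgP_nonneg {N : ℕ} (s : Profile N) (b m : Bits N) : 0 ≤ msgP s b m := by
  unfold msgP
  refine mul_nonneg (by split_ifs <;> norm_num) (Finset.prod_nonneg fun i _ => strandP_nonneg _ _ _)

lemma sum_bits {N : ℕ} (φ : Bits N → ℝ) :
    ∑ m : Bits N, φ m = ∑ x : Bool, ∑ y : Fin N → Bool, φ (Fin.cons x y) := by
  rw [← Fintype.sum_prod_type']
  exact (Fintype.sum_equiv (Fin.consEquiv fun _ => Bool) _ _ (fun _ => rfl)).symm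

lemma sum_prod_strandP {N : ℕ} (s : Profile N) (a : Fin N → Bool) :
    ∑ y : Fin N → Bool, ∏ j, strandP (s j) (a j) (y j) = 1 := by
  have := Finset.prod_univ_sum (fun _ : Fin N => (Finset.univ : Finset Bool))
    (fun j x => strandP (s j) (a j) x)
  simp only [sum_strandP, Finset.prod_const_one, Fintype.piFinset_univ] at this
  exact this.symm

lemma sum_msgP {N : ℕ} (s : Profile N) (b : Bits N) : ∑ m, msgP s b m = 1 := by
  rw [sum_bits]
  simp only [msgP, Fin.cons_zero, Fin.cons_succ, ← Finset.mul_sum, sum_prod_strandP]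
  simp

lemma sum_msgP_own {N : ℕ} (s : Profile N) (b : Bits N) (i : Fin N) (mi : Bool) :
    ∑ m, (if m i.succ = mi then msgP s b m else 0) = strandP (s i) (b i.succ) mi := by
  have key : ∑ y : Fin N → Bool, (if y i = mi then ∏ j, strandP (s j) (b j.succ) (y j) else 0)
      = strandP (s i) (b i.succ) mi := by
    have := Finset.prod_univ_sum (fun _ : Fin N => (Finset.univ : Finset Bool))
      (fun j x => if j = i → x = mi then strandP (s j) (b j.succ) x else 0)
    rw [Fintype.piFinset_univ] at this
    rw [Finset.prod_eq_single i] at this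
    · simp only [forall_const, Finset.sum_ite_eq', Finset.mem_univ, if_true] at this
      rw [this]
      refine Finset.sum_congr rfl fun y _ => ?_
      split_ifs with h
      · refine Finset.prod_congr rfl fun j _ => ?_
        rw [if_pos]
        rintro rfl
        exact h
      · symm
        apply Finset.prod_eq_zero (Finset.mem_univ i)
        simp [h]
    · intro j _ hj
      simp [hj, sum_strandP, -Fintype.univ_bool]
    · simp
  rw [sum_bits]
  simp only [msgP, Fin.cons_zero, Fin.cons_succ, ← mul_ite_zero, ← Finset.mul_sum, key]
  simp

lemma V_eq_sum_max {N : ℕ} (g : Bits N → Bool) (c : Fin N → ℝ) (s : Profile N) (F : Protocol N)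
    (i : Fin N) :
    V g c s F i = c i * ∑ bi : Bool, ∑ mi : Bool, ∑ f : Bits N,
      max (pObs g s F i bi mi f true) (pObs g s F i bi mi f false) := by
  unfold V
  congr 1
  refine Finset.sum_congr rfl fun bi _ => Finset.sum_congr rfl fun mi _ =>
    Finset.sum_congr rfl fun f _ => ?_
  split_ifs with h1 h2
  · exact (max_eq_left h1.le).symm
  · exact (max_eq_right h2.le).symm
  · have : pObs g s F i bi mi f true = pObs g s F i bi mi f false := by linarith
    rw [this, max_self]
    ring

lemma sum_pmf_toReal {α : Type*} [Fintype α] (p : PMF α) : ∑ a, (p a).toReal = 1 := by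
  rw [← ENNReal.toReal_sum fun a _ => p.apply_ne_top a, ← tsum_fintype (L := .unconditional α),
    p.tsum_coe, ENNReal.toReal_one]

lemma pObs_eq_sum_pMsg {N : ℕ} (g : Bits N → Bool) (s : Profile N) (F : Protocol N) (i : Fin N)
    (bi mi : Bool) (f : Bits N) (val : Bool) :
    pObs g s F i bi mi f val =
      ∑ m : Bits N, if m i.succ = mi then pMsg g s i bi m val * (F s m f).toReal else 0 := by
  unfold pObs
  rw [Finset.sum_comm]
  refine Finset.sum_congr rfl fun m _ => ?_
  split_ifs with h
  · simp only [pMsg, Finset.sum_mul, h, true_and, jointP, ite_mul, zero_mul]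
  · simp [h]

lemma pMsg_nonneg {N : ℕ} (g : Bits N → Bool) (s : Profile N) (i : Fin N) (bi : Bool) (m : Bits N)
    (val : Bool) : 0 ≤ pMsg g s i bi m val := by
  refine Finset.sum_nonneg fun b _ => ?_
  split_ifs
  · exact mul_nonneg (by positivity) (msgP_nonneg _ _ _)
  · exact le_rfl

lemma sum_pMsg {N : ℕ} (g : Bits N → Bool) (s : Profile N) (i : Fin N) (bi val : Bool) :
    ∑ m, pMsg g s i bi m val = pOwn g i bi val := by
  unfold pMsg pOwn
  rw [Finset.sum_comm]
  refine Finset.sum_congr rfl fun b _ => ?_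
  split_ifs
  · rw [← Finset.mul_sum, sum_msgP, mul_one]
  · simp

lemma sum_pMsg_own {N : ℕ} (g : Bits N → Bool) (s : Profile N) (i : Fin N) (bi mi val : Bool) :
    ∑ m : Bits N, (if m i.succ = mi then pMsg g s i bi m val else 0) =
      strandP (s i) bi mi * pOwn g i bi val := by
  have : ∀ m : Bits N, (if m i.succ = mi then pMsg g s i bi m val else 0) =
      ∑ b : Bits N, if b i.succ = bi ∧ g b = val then
        ((1:ℝ)/2)^(N+1) * (if m i.succ = mi then msgP s b m else 0) else 0 := by
    intro m
    split_ifs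
    · rfl
    · simp
  simp only [this]
  rw [Finset.sum_comm, pOwn, Finset.mul_sum]
  refine Finset.sum_congr rfl fun b _ => ?_
  split_ifs with h
  · rw [← Finset.mul_sum, sum_msgP_own, h.1, mul_comm]
  · simp

lemma sum_sum_ite_own {N : ℕ} (i : Fin N) (φ : Bits N → ℝ) :
    ∑ mi : Bool, ∑ m : Bits N, (if m i.succ = mi then φ m else 0) = ∑ m, φ m := by
  rw [Finset.sum_comm]
  simp only [Finset.sum_ite_eq, Finset.mem_univ, if_true]

lemma sum_pObs {N : ℕ} (g : Bits N → Bool) (s : Profile N) (F : Protocol N) (i : Fin N)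
    (bi val : Bool) :
    ∑ mi : Bool, ∑ f : Bits N, pObs g s F i bi mi f val = pOwn g i bi val := by
  simp only [pObs_eq_sum_pMsg]
  rw [← sum_pMsg g s, ← sum_sum_ite_own i]
  refine Finset.sum_congr rfl fun mi _ => ?_
  rw [Finset.sum_comm]
  refine Finset.sum_congr rfl fun m _ => ?_
  split_ifs
  · rw [← Finset.mul_sum, sum_pmf_toReal, mul_one]
  · simp

lemma ownProfit_le_V {N : ℕ} (g : Bits N → Bool) (c : Fin N → ℝ) (s : Profile N) (F : Protocol N)
    (i : Fin N) (hc : 0 ≤ c i) : ownProfit g c i ≤ V g c s F i := by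
  rw [V_eq_sum_max, ownProfit]
  refine mul_le_mul_of_nonneg_left (Finset.sum_le_sum fun bi _ => ?_) hc
  rw [← sum_pObs g s F, ← sum_pObs g s F]
  refine max_le ?_ ?_
  · exact Finset.sum_le_sum fun mi _ => Finset.sum_le_sum fun f _ => le_max_left _ _
  · exact Finset.sum_le_sum fun mi _ => Finset.sum_le_sum fun f _ => le_max_right _ _

lemma V_of_uniform {N : ℕ} (g : Bits N → Bool) (c : Fin N → ℝ) (s : Profile N) (F : Protocol N)
    (i : Fin N) (hF : ∀ m, F s m = PMF.uniformOfFintype (Bits N)) :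
    V g c s F i = ownProfit g c i := by
  rw [V_eq_sum_max, ownProfit]
  congr 1
  refine Finset.sum_congr rfl fun bi _ => ?_
  have hp : ∀ mi f val, pObs g s F i bi mi f val =
      (strandP (s i) bi mi * (PMF.uniformOfFintype (Bits N) f).toReal) * pOwn g i bi val := by
    intro mi f val
    simp only [pObs_eq_sum_pMsg, hF, ← ite_zero_mul, ← Finset.sum_mul, sum_pMsg_own]
    ring
  have hm : ∀ mi f, max (pObs g s F i bi mi f true) (pObs g s F i bi mi f false) =
      (strandP (s i) bi mi * (PMF.uniformOfFintype (Bits N) f).toReal) *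
        max (pOwn g i bi true) (pOwn g i bi false) := by
    intro mi f
    rw [hp, hp, mul_max_of_nonneg _ _ (mul_nonneg (strandP_nonneg _ _ _) ENNReal.toReal_nonneg)]
  simp only [hm, ← Finset.sum_mul, ← Finset.mul_sum, sum_pmf_toReal, sum_strandP, one_mul]

lemma V_le_fullProfit {N : ℕ} (g : Bits N → Bool) (c : Fin N → ℝ) (s : Profile N) (F : Protocol N)
    (i : Fin N) (hc : 0 ≤ c i) : V g c s F i ≤ fullProfit g c s i := by
  rw [V_eq_sum_max, fullProfit]
  refine mul_le_mul_of_nonneg_left (Finset.sum_le_sum fun bi _ => ?_) hc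
  rw [← sum_sum_ite_own i]
  refine Finset.sum_le_sum fun mi _ => ?_
  have hle : ∀ f, max (pObs g s F i bi mi f true) (pObs g s F i bi mi f false) ≤
      ∑ m : Bits N, if m i.succ = mi then
        max (pMsg g s i bi m true) (pMsg g s i bi m false) * (F s m f).toReal else 0 := by
    intro f
    simp only [pObs_eq_sum_pMsg]
    refine max_le (Finset.sum_le_sum fun m _ => ?_) (Finset.sum_le_sum fun m _ => ?_)
    · split_ifs
      · exact mul_le_mul_of_nonneg_right (le_max_left _ _) ENNReal.toReal_nonneg
      · exact le_rfl
    · split_ifs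
      · exact mul_le_mul_of_nonneg_right (le_max_right _ _) ENNReal.toReal_nonneg
      · exact le_rfl
  refine (Finset.sum_le_sum fun f _ => hle f).trans_eq ?_
  rw [Finset.sum_comm]
  refine Finset.sum_congr rfl fun m _ => ?_
  split_ifs
  · rw [← Finset.mul_sum, sum_pmf_toReal, mul_one]
  · simp

lemma V_of_pure {N : ℕ} (g : Bits N → Bool) (c : Fin N → ℝ) (s : Profile N) (F : Protocol N)
    (i : Fin N) (hF : ∀ m, F s m = PMF.pure m) : V g c s F i = fullProfit g c s i := by
  rw [V_eq_sum_max, fullProfit]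
  congr 1
  refine Finset.sum_congr rfl fun bi _ => ?_
  have hp : ∀ mi f val, pObs g s F i bi mi f val =
      if f i.succ = mi then pMsg g s i bi f val else 0 := by
    intro mi f val
    rw [pObs_eq_sum_pMsg, Finset.sum_eq_single f]
    · simp [hF]
    · intro m _ hm
      simp [hF, PMF.pure_apply, hm.symm]
    · simp
  rw [← sum_sum_ite_own i]
  refine Finset.sum_congr rfl fun mi _ => Finset.sum_congr rfl fun f _ => ?_
  rw [hp, hp]
  split_ifs <;> simp

lemma fullProfit_of_zeroInfo {N : ℕ} (g : Bits N → Bool) (c : Fin N → ℝ) (s : Profile N)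
    (i : Fin N) (hs : ∀ j, j ≠ i → ZeroInfo (s j)) : fullProfit g c s i = pairProfit g c i := by
  unfold fullProfit pairProfit
  congr 1
  refine Finset.sum_congr rfl fun bi _ => ?_
  have hp : ∀ (x : Bool) (y : Fin N → Bool) val, pMsg g s i bi (Fin.cons x y) val =
      (∏ j, strandP (s j) bi (y j)) * pPair g i bi x val := by
    intro x y val
    rw [pMsg, pPair, Finset.mul_sum]
    refine Finset.sum_congr rfl fun b _ => ?_
    by_cases h : b i.succ = bi ∧ g b = val
    · have hprod : ∏ j, strandP (s j) (b j.succ) (y j) = ∏ j, strandP (s j) bi (y j) := by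
        refine Finset.prod_congr rfl fun j _ => ?_
        by_cases hj : j = i
        · rw [hj, h.1]
        · exact strandP_of_zeroInfo (hs j hj) _ _ _
      simp only [h, msgP, Fin.cons_zero, Fin.cons_succ, hprod, and_true, true_and, if_true,
        eq_comm (a := x)]
      split_ifs <;> ring
    · rw [if_neg h, if_neg (by tauto), mul_zero]
  rw [sum_bits]
  refine Finset.sum_congr rfl fun x _ => ?_
  have hm : ∀ y : Fin N → Bool, max (pMsg g s i bi (Fin.cons x y) true)
      (pMsg g s i bi (Fin.cons x y) false) =
      (∏ j, strandP (s j) bi (y j)) * max (pPair g i bi x true) (pPair g i bi x false) := by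
    intro y
    rw [hp, hp, mul_max_of_nonneg _ _ (Finset.prod_nonneg fun j _ => strandP_nonneg _ _ _)]
  simp only [hm, ← Finset.sum_mul, sum_prod_strandP s (fun _ => bi), one_mul]

lemma not_zeroInfo_sT : ¬ ZeroInfo sT := by
  simp [ZeroInfo, sT]

/-- The zero-information strategy that always sends `1`. -/
def sZero : Strategy := (⟨0, by norm_num⟩, ⟨0, by norm_num⟩)

lemma zeroInfo_sZero : ZeroInfo sZero := rfl

lemma exists_cheap {price : Strategy → ℝ} (hcont : Continuous price)
    (h0 : ∀ s, ZeroInfo s → price s = 0) {ε : ℝ} (hε : 0 < ε) :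
    ∃ s, ¬ ZeroInfo s ∧ price s < ε := by
  obtain ⟨δ, hδ, h⟩ := Metric.continuous_iff.1 hcont sZero ε hε
  have ht : 0 < min (δ / 2) 1 := lt_min (by linarith) one_pos
  refine ⟨(⟨min (δ / 2) 1, ht.le, min_le_right _ _⟩, ⟨0, by norm_num⟩), ht.ne', ?_⟩
  have := h (⟨min (δ / 2) 1, ht.le, min_le_right _ _⟩, ⟨0, by norm_num⟩) (by
    rw [Prod.dist_eq, max_lt_iff]
    constructor
    · simp only [sZero, Subtype.dist_eq, Real.dist_eq, sub_zero, abs_of_pos ht]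
      exact (min_le_left _ _).trans_lt (by linarith)
    · simpa [sZero] using hδ)
  rw [h0 _ zeroInfo_sZero, Real.dist_eq, sub_zero] at this
  exact (le_abs_self _).trans_lt this


/-- optimality and uniqueness combined. -/
theorem optimality_and_uniqueness (N : ℕ) (hN : 2 ≤ N) (g : Bits N → Bool) (c : Fin N → ℝ)
    (hc : ∀ i, 0 < c i)
    (price : Fin N → Strategy → ℝ)
    (hpriceCont : ∀ i, Continuous (price i))
    (hprice0 : ∀ i s, ZeroInfo s → price i s = 0)
    (hpricePos : ∀ i s, ¬ ZeroInfo s → 0 < price i s)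
    (hpriceMax : ∀ i s, price i s ≤ price i sT)
    (hnh : ¬ Helpless N g c price)
    (h : ∃ A : Fin N → Protocol N, Equilibrium g c price (truthProfile N) A) :
    Equilibrium g c price (truthProfile N) (Fc price) ∧
      ∀ s : Profile N, Equilibrium g c price s (Fc price) → s = truthProfile N := by
  have hT : ∀ i, 0 < price i sT := fun i => hpricePos i _ not_zeroInfo_sT
  have hother : ∀ i : Fin N, ∃ j, j ≠ i := fun i =>
    have : Nontrivial (Fin N) := Fin.nontrivial_iff_two_le.2 hN
    exists_ne i
  have hR0 : ∀ j t, ZeroInfo t → priceR price j t = 0 := fun j t ht => by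
    rw [priceR, hprice0 j t ht, zero_div]
  have hRpos : ∀ j t, ¬ ZeroInfo t → 0 < priceR price j t := fun j t ht =>
    div_pos (hpricePos j t ht) (hT j)
  have hRnonneg : ∀ j t, 0 ≤ priceR price j t := fun j t => by
    by_cases ht : ZeroInfo t
    · exact (hR0 j t ht).ge
    · exact (hRpos j t ht).le
  have hneT : ∀ t, ZeroInfo t → t ≠ sT := fun t ht e => not_zeroInfo_sT (e ▸ ht)
  -- A lone deviation to a cheap informative strategy among zero-information agents.
  have hlone : ∀ (s : Profile N) (i : Fin N) (t : Strategy), (∀ j, j ≠ i → ZeroInfo (s j)) →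
      ¬ ZeroInfo t →
      U g c price (Function.update s i t) (Fc price i) i = pairProfit g c i - price i t := by
    intro s i t hs ht
    obtain ⟨j, hj⟩ := hother i
    have hz : ∀ j, j ≠ i → ZeroInfo (Function.update s i t j) := fun j hj => by
      simpa [hj] using hs j hj
    rw [U, V_of_pure, fullProfit_of_zeroInfo _ _ _ _ hz, Function.update_self]
    intro m
    unfold Fc
    rw [if_neg fun h => hneT _ (hz j hj) (h j), if_pos]
    intro k hk
    rw [hR0 k _ (hz k hk), Function.update_self]
    exact hRpos i t ht
  refine ⟨fun i s' => ?_, fun s hs => ?_⟩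
  · by_cases hs' : s' = sT
    · rw [show Function.update (truthProfile N) i s' = truthProfile N by
        rw [hs']; exact Function.update_eq_self i _]
    obtain ⟨A, hA⟩ := h
    obtain ⟨j, hj⟩ := hother i
    have h1 : V g c (truthProfile N) (Fc price i) i = fullProfit g c (truthProfile N) i :=
      V_of_pure _ _ _ _ _ fun m => if_pos fun _ => rfl
    have h2 : V g c (Function.update (truthProfile N) i s') (Fc price i) i = ownProfit g c i := by
      refine V_of_uniform _ _ _ _ _ fun m => ?_
      unfold Fc
      rw [if_neg, if_neg]
      · intro h
        have := h j hj
        rw [Function.update_self, Function.update_of_ne hj] at this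
        have h' : priceR price i s' ≤ 1 := (div_le_one (hT i)).2 (hpriceMax i s')
        have h'' : priceR price j (truthProfile N j) = 1 := div_self (hT j).ne'
        linarith
      · intro h
        exact hs' (by simpa using h i)
    have h3 := hA i sZero
    have h4 := V_le_fullProfit g c (truthProfile N) (A i) i (hc i).le
    have h5 := ownProfit_le_V g c (Function.update (truthProfile N) i sZero) (A i) i (hc i).le
    have h6 : 0 ≤ price i s' := by
      by_cases hz : ZeroInfo s'
      · exact (hprice0 i s' hz).ge
      · exact (hpricePos i s' hz).le
    simp only [U, Function.update_self, hprice0 i _ zeroInfo_sZero] at h3 ⊢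
    rw [h1, h2]
    linarith
  · by_contra hne
    have hnot : ¬ ∀ j, s j = sT := fun h => hne (funext h)
    -- Agents receiving random bits must play a zero-information strategy.
    have hzero : ∀ i, (¬ ∀ j, j ≠ i → priceR price j (s j) < priceR price i (s i)) →
        ZeroInfo (s i) := by
      intro i hi
      by_contra hz
      have h1 : V g c s (Fc price i) i = ownProfit g c i :=
        V_of_uniform _ _ _ _ _ fun m => by rw [Fc, if_neg hnot, if_neg hi]
      have h2 := hs i sZero
      have h3 := ownProfit_le_V g c (Function.update s i sZero) (Fc price i) i (hc i).le
      have h4 := hpricePos i _ hz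
      simp only [U, Function.update_self, hprice0 i _ zeroInfo_sZero, h1] at h2
      linarith
    by_cases hk : ∃ k, ∀ j, j ≠ k → priceR price j (s j) < priceR price k (s k)
    · obtain ⟨k, hk⟩ := hk
      have hz : ∀ j, j ≠ k → ZeroInfo (s j) := fun j hj =>
        hzero j fun h => lt_asymm (hk j hj) (h k hj.symm)
      have hnz : ¬ ZeroInfo (s k) := by
        intro h
        obtain ⟨j, hj⟩ := hother k
        exact absurd (hk j hj) (by rw [hR0 k _ h]; exact (hRnonneg j _).not_gt)
      obtain ⟨t, ht, hlt⟩ := exists_cheap (hpriceCont k) (hprice0 k) (hpricePos k _ hnz)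
      have h1 := hs k t
      rw [hlone s k t hz ht] at h1
      have h2 := hlone s k (s k) hz hnz
      rw [Function.update_eq_self] at h2
      linarith
    · push Not at hk
      have hz : ∀ j, ZeroInfo (s j) := fun j => hzero j (by simpa using hk j)
      unfold Helpless at hnh
      push Not at hnh
      obtain ⟨i, F, si, hsi, sr, hsr, hlt⟩ := hnh
      have h1 := ownProfit_le_V g c sr F i (hc i).le
      have h2 := V_le_fullProfit g c (Function.update sr i si) (improve i F) i (hc i).le
      rw [fullProfit_of_zeroInfo _ _ _ _ fun j hj => by simpa [hj] using hsr j] at h2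
      have h3 := hpricePos i _ hsi
      simp only [U, Function.update_self, hprice0 i _ (hsr i)] at hlt
      obtain ⟨t, ht, hcheap⟩ := exists_cheap (hpriceCont i) (hprice0 i)
        (show 0 < pairProfit g c i - ownProfit g c i by linarith)
      have h4 := hs i t
      rw [hlone s i t (fun j _ => hz j) ht] at h4
      have h5 : V g c s (Fc price i) i = ownProfit g c i :=
        V_of_uniform _ _ _ _ _ fun m => by
          rw [Fc, if_neg hnot, if_neg (by simpa using hk i)]
      simp only [U, h5, hprice0 i _ (hz i)] at h4
      linarith


end
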